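/- For every fixed natural number k, the normalized Jacobi polynomials satisfy lim_{n→∞} (−1)^n (P̃_n^{(α,β)})^{(k)}(−1) / n^{−α+β+2k} = Γ(α+1) / ((−2)^k Γ(β+k+1)). -/

import Mathlib

open MeasureTheory Polynomial Filter

theorem ascPochhammer_succ_eval_left (n : ℕ) (x : ℝ) :
    (ascPochhammer ℝ (n + 1)).eval x = x * (ascPochhammer ℝ n).eval (x + 1) := by
  simp [ascPochhammer_succ_left]

/-- The Chu–Vandermonde identity `₂F₁(-n, b; c; 1) = (c - b)_n / (c)_n`. -/
theorem sum_choose_mul_ascPochhammer_div (n : ℕ) (b c : ℝ) (hc : 0 < c) :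
    ∑ j ∈ Finset.range (n + 1), (-1) ^ j * (n.choose j : ℝ) *
      ((ascPochhammer ℝ j).eval b / (ascPochhammer ℝ j).eval c)
      = (ascPochhammer ℝ n).eval (c - b) / (ascPochhammer ℝ n).eval c := by
  induction n generalizing b c with
  | zero => simp
  | succ n ih =>
    have hsplit : ∑ j ∈ Finset.range (n + 1 + 1), (-1) ^ j * ((n + 1).choose j : ℝ) *
          ((ascPochhammer ℝ j).eval b / (ascPochhammer ℝ j).eval c)
        = ∑ j ∈ Finset.range (n + 1), (-1) ^ j * (n.choose j : ℝ) *
            ((ascPochhammer ℝ j).eval b / (ascPochhammer ℝ j).eval c)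
          - b / c * ∑ j ∈ Finset.range (n + 1), (-1) ^ j * (n.choose j : ℝ) *
            ((ascPochhammer ℝ j).eval (b + 1) / (ascPochhammer ℝ j).eval (c + 1)) := by
      have hextend : ∑ j ∈ Finset.range (n + 1), (-1) ^ j * (n.choose j : ℝ) *
            ((ascPochhammer ℝ j).eval b / (ascPochhammer ℝ j).eval c)
          = ∑ j ∈ Finset.range (n + 1 + 1), (-1) ^ j * (n.choose j : ℝ) *
            ((ascPochhammer ℝ j).eval b / (ascPochhammer ℝ j).eval c) := by
        rw [Finset.sum_range_succ _ (n + 1)]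
        simp
      rw [hextend, Finset.sum_range_succ' _ (n + 1), Finset.sum_range_succ' _ (n + 1),
        Finset.mul_sum, add_sub_right_comm, ← Finset.sum_sub_distrib]
      congr 1
      · refine Finset.sum_congr rfl fun j _ => ?_
        rw [ascPochhammer_succ_eval_left, ascPochhammer_succ_eval_left, Nat.choose_succ_succ,
          mul_div_mul_comm]
        push_cast
        ring
      · simp
    have hc₁ : 0 < (ascPochhammer ℝ n).eval (c + 1) := ascPochhammer_pos _ _ (by linarith)
    have hc₀ : 0 < (ascPochhammer ℝ n).eval c := ascPochhammer_pos _ _ hc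
    have hshift : (ascPochhammer ℝ n).eval c * (c + n) = c * (ascPochhammer ℝ n).eval (c + 1) := by
      rw [← ascPochhammer_succ_eval, ascPochhammer_succ_eval_left]
    rw [hsplit, ih b c hc, ih (b + 1) (c + 1) (by linarith), ascPochhammer_succ_eval_left n c,
      ascPochhammer_succ_eval, add_sub_add_right_eq_sub]
    field_simp
    linear_combination -(ascPochhammer ℝ n).eval (c - b) * hshift

theorem ascPochhammer_eval_neg_natCast_add (n : ℕ) (a : ℝ) :
    (ascPochhammer ℝ n).eval (-(n + a)) = (-1) ^ n * (ascPochhammer ℝ n).eval (a + 1) := by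
  rw [ascPochhammer_eval_neg_eq_descPochhammer, descPochhammer_eval_eq_ascPochhammer]
  congr 2
  ring

theorem Real.Gamma_add_natCast (x : ℝ) (hx : 0 < x) (n : ℕ) :
    Real.Gamma (x + n) = (ascPochhammer ℝ n).eval x * Real.Gamma x := by
  induction n with
  | zero => simp
  | succ n ih =>
    rw [Nat.cast_succ, ← add_assoc, Real.Gamma_add_one (by positivity), ih,
      ascPochhammer_succ_eval]
    ring

theorem integral_one_sub_rpow_mul_one_add_rpow (a b : ℝ) (ha : -1 < a) (hb : -1 < b) :
    ∫ x in Set.Ioo (-1 : ℝ) 1, (1 - x) ^ a * (1 + x) ^ b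
      = 2 ^ (a + b + 1) * (Real.Gamma (a + 1) * Real.Gamma (b + 1) / Real.Gamma (a + b + 2)) := by
  have hbeta : (Complex.betaIntegral (b + 1 : ℝ) (a + 1 : ℝ))
      = ((Real.Gamma (a + 1) * Real.Gamma (b + 1) / Real.Gamma (a + b + 2) : ℝ) : ℂ) := by
    rw [Complex.betaIntegral_eq_Gamma_mul_div _ _ (by simp; linarith) (by simp; linarith),
      ← Complex.ofReal_add, Complex.Gamma_ofReal, Complex.Gamma_ofReal, Complex.Gamma_ofReal,
      show b + 1 + (a + 1) = a + b + 2 by ring]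
    push_cast
    ring
  have hscaled := Complex.betaIntegral_scaled (b + 1 : ℝ) (a + 1 : ℝ) (a := 2) two_pos
  rw [hbeta] at hscaled
  rw [← integral_Ioc_eq_integral_Ioo, ← intervalIntegral.integral_of_le (by norm_num)]
  have hshift : ∫ x in (-1 : ℝ)..1, (1 - x) ^ a * (1 + x) ^ b
      = ∫ x in (0 : ℝ)..2, x ^ b * (2 - x) ^ a := by
    have h := intervalIntegral.integral_comp_add_left
      (fun x : ℝ => x ^ b * (2 - x) ^ a) (a := -1) (b := 1) 1
    norm_num at h
    rw [← h]
    refine intervalIntegral.integral_congr fun x _ => ?_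
    rw [mul_comm]
    congr 2
    ring
  apply Complex.ofReal_injective
  rw [hshift, ← intervalIntegral.integral_ofReal]
  convert hscaled using 1
  · refine intervalIntegral.integral_congr fun x hx => ?_
    rw [Set.uIcc_of_le (by norm_num)] at hx
    rw [Complex.ofReal_mul, Complex.ofReal_cpow hx.1, Complex.ofReal_cpow (by linarith [hx.2])]
    push_cast
    simp
  · rw [Complex.ofReal_mul, Complex.ofReal_cpow (by norm_num)]
    congr 2
    push_cast
    ring

theorem integrableOn_one_sub_rpow_mul_one_add_rpow (a b : ℝ) (ha : -1 < a) (hb : -1 < b) :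
    IntegrableOn (fun x : ℝ => (1 - x) ^ a * (1 + x) ^ b) (Set.Ioo (-1 : ℝ) 1) := by
  by_contra h
  have hval := integral_one_sub_rpow_mul_one_add_rpow a b ha hb
  rw [integral_undef h] at hval
  have := Real.Gamma_pos_of_pos (show 0 < a + 1 by linarith)
  have := Real.Gamma_pos_of_pos (show 0 < b + 1 by linarith)
  have := Real.Gamma_pos_of_pos (show 0 < a + b + 2 by linarith)
  exact absurd hval (by positivity)

theorem integrableOn_eval_mul_jacobiWeight (a b : ℝ) (ha : -1 < a) (hb : -1 < b) (p : ℝ[X]) :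
    IntegrableOn (fun x : ℝ => p.eval x * ((1 - x) ^ a * (1 + x) ^ b)) (Set.Ioo (-1 : ℝ) 1) :=
  (integrableOn_one_sub_rpow_mul_one_add_rpow a b ha hb).continuousOn_mul_of_subset
    p.continuous.continuousOn isCompact_Icc measurableSet_Ioo Set.Ioo_subset_Icc_self

/-- Integration of polynomials against the Jacobi weight `(1 - x) ^ a * (1 + x) ^ b`. -/
noncomputable def jacobiFunctional (a b : ℝ) (ha : -1 < a) (hb : -1 < b) :
    ℝ[X] →ₗ[ℝ] ℝ where
  toFun p := ∫ x in Set.Ioo (-1 : ℝ) 1, p.eval x * ((1 - x) ^ a * (1 + x) ^ b)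
  map_add' p q := by
    rw [← integral_add (integrableOn_eval_mul_jacobiWeight a b ha hb p)
      (integrableOn_eval_mul_jacobiWeight a b ha hb q)]
    simp [add_mul]
  map_smul' r p := by
    simp [mul_assoc, integral_const_mul]

section Jacobi

variable {a b : ℝ} (ha : -1 < a) (hb : -1 < b)

theorem jacobiFunctional_apply (p : ℝ[X]) :
    jacobiFunctional a b ha hb p
      = ∫ x in Set.Ioo (-1 : ℝ) 1, p.eval x * ((1 - x) ^ a * (1 + x) ^ b) := rfl

theorem eq_zero_of_jacobiFunctional_mul_self (p : ℝ[X])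
    (h : jacobiFunctional a b ha hb (p * p) = 0) : p = 0 := by
  rw [jacobiFunctional_apply, setIntegral_eq_zero_iff_of_nonneg_ae
    ?_ (integrableOn_eval_mul_jacobiWeight a b ha hb _)] at h
  · by_contra hp
    have hroots : volume {x : ℝ | p.IsRoot x} = 0 :=
      (Polynomial.finite_setOfPred_isRoot hp).measure_zero _
    have hzero : ∀ᵐ x ∂volume.restrict (Set.Ioo (-1 : ℝ) 1), False := by
      filter_upwards [h, ae_restrict_mem measurableSet_Ioo,
        ae_restrict_of_ae (measure_eq_zero_iff_ae_notMem.1 hroots)] with x hx hmem hnot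
      have h₁ : 0 < (1 - x) ^ a := Real.rpow_pos_of_pos (by linarith [hmem.2]) _
      have h₂ : 0 < (1 + x) ^ b := Real.rpow_pos_of_pos (by linarith [hmem.1]) _
      simp only [eval_mul, Pi.zero_apply, mul_eq_zero, h₁.ne', h₂.ne', or_false, or_self] at hx
      exact hnot hx
    rw [Filter.eventually_false_iff_eq_bot, ae_eq_bot, Measure.restrict_eq_zero,
      Real.volume_Ioo] at hzero
    norm_num at hzero
  · filter_upwards [ae_restrict_mem measurableSet_Ioo] with x hmem
    have h₁ : 0 < (1 - x) ^ a := Real.rpow_pos_of_pos (by linarith [hmem.2]) _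
    have h₂ : 0 < (1 + x) ^ b := Real.rpow_pos_of_pos (by linarith [hmem.1]) _
    rw [eval_mul]
    exact mul_nonneg (mul_self_nonneg _) (by positivity)

theorem jacobiFunctional_one_sub_X_pow_mul_X_add_one_pow (i j : ℕ) :
    jacobiFunctional a b ha hb ((1 - X) ^ i * (X + C 1) ^ j)
      = 2 ^ (a + b + i + 1) * Real.Gamma (a + i + 1) * Real.Gamma (b + 1)
        / Real.Gamma (a + b + i + 2) * (2 ^ j * ((ascPochhammer ℝ j).eval (b + 1)
          / (ascPochhammer ℝ j).eval (a + b + i + 2))) := by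
  have hi : (0 : ℝ) ≤ i := i.cast_nonneg
  have hj : (0 : ℝ) ≤ j := j.cast_nonneg
  have hint := integral_one_sub_rpow_mul_one_add_rpow (a + i) (b + j) (by linarith) (by linarith)
  rw [jacobiFunctional_apply, setIntegral_congr_fun (g := fun x : ℝ =>
    (1 - x) ^ (a + i) * (1 + x) ^ (b + j)) measurableSet_Ioo, hint,
    show a + i + (b + j) + 2 = a + b + i + 2 + j by ring,
    show b + j + 1 = b + 1 + j by ring, show a + i + (b + j) + 1 = a + b + i + 1 + j by ring,
    Real.Gamma_add_natCast (b + 1) (by linarith),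
    Real.Gamma_add_natCast (a + b + i + 2) (by linarith), Real.rpow_add_natCast (by norm_num)]
  · have := (ascPochhammer_pos j (a + b + i + 2) (by linarith)).ne'
    have := (Real.Gamma_pos_of_pos (show 0 < a + b + i + 2 by linarith)).ne'
    field_simp
  · intro x hx
    simp only [eval_mul, eval_pow, eval_sub, eval_one, eval_X, eval_add, eval_C]
    rw [Real.rpow_add_natCast (by linarith [hx.2]), Real.rpow_add_natCast (by linarith [hx.1])]
    ring

theorem jacobiFunctional_comp_mul_eq_zero {p q r : ℝ[X]} {n : ℕ}
    (hr : ∀ i < n, jacobiFunctional a b ha hb (q ^ i * r) = 0) (hp : p.degree < n) :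
    jacobiFunctional a b ha hb (p.comp q * r) = 0 := by
  rw [comp, eval₂_eq_sum, sum_def, Finset.sum_mul, map_sum]
  refine Finset.sum_eq_zero fun i hi => ?_
  have hin : i < n := by exact_mod_cast (le_degree_of_mem_supp i hi).trans_lt hp
  rw [mul_assoc, ← smul_eq_C_mul, map_smul, hr i hin, smul_zero]

/-- The Jacobi polynomial `₂F₁(-n, n + a + b + 1; b + 1; (1 + x) / 2)`, expanded at `-1`. -/
noncomputable def jacobiAtNegOne (a b : ℝ) (n : ℕ) : ℝ[X] :=
  ∑ j ∈ Finset.range (n + 1), C ((-1) ^ j * (n.choose j : ℝ) *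
    ((ascPochhammer ℝ j).eval (n + a + b + 1) / (ascPochhammer ℝ j).eval (b + 1)) / 2 ^ j)
      * (X + C 1) ^ j

theorem jacobiAtNegOne_degree_le (n : ℕ) : (jacobiAtNegOne a b n).degree ≤ n := by
  refine (degree_sum_le _ _).trans (Finset.sup_le fun j hj => ?_)
  rw [← smul_eq_C_mul]
  refine (degree_smul_le _ _).trans ?_
  rw [degree_pow, degree_X_add_C, nsmul_one]
  exact_mod_cast Finset.mem_range_succ_iff.1 hj

include hb in
theorem jacobiAtNegOne_eval_one (n : ℕ) : (jacobiAtNegOne a b n).eval 1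
    = (-1) ^ n * (ascPochhammer ℝ n).eval (a + 1) / (ascPochhammer ℝ n).eval (b + 1) := by
  have h := sum_choose_mul_ascPochhammer_div n (n + a + b + 1) (b + 1) (by linarith)
  rw [show b + 1 - (n + a + b + 1) = -(n + a) by ring, ascPochhammer_eval_neg_natCast_add] at h
  rw [← h, jacobiAtNegOne, eval_finsetSum]
  refine Finset.sum_congr rfl fun j _ => ?_
  simp only [eval_mul, eval_C, eval_pow, eval_add, eval_X]
  norm_num

theorem jacobiAtNegOne_iterate_derivative_eval (n k : ℕ) (hk : k ≤ n) :
    (derivative^[k] (jacobiAtNegOne a b n)).eval (-1)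
      = (-1) ^ k * (n.descFactorial k : ℝ) *
        ((ascPochhammer ℝ k).eval (n + a + b + 1) / (ascPochhammer ℝ k).eval (b + 1)) / 2 ^ k := by
  rw [jacobiAtNegOne, iterate_derivative_sum, eval_finsetSum, Finset.sum_eq_single k]
  · rw [iterate_derivative_C_mul, iterate_derivative_X_add_pow, Nat.descFactorial_self,
      Nat.descFactorial_eq_factorial_mul_choose]
    simp
    ring
  · intro j _ hj
    rw [iterate_derivative_C_mul, iterate_derivative_X_add_pow]
    rcases hj.lt_or_gt with h | h
    · simp [Nat.descFactorial_of_lt h]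
    · simp [Nat.sub_ne_zero_of_lt h]
  · intro h
    exact absurd (Finset.mem_range_succ_iff.2 hk) h

theorem jacobiFunctional_one_sub_X_pow_mul_jacobiAtNegOne (i n : ℕ) (hi : i < n) :
    jacobiFunctional a b ha hb ((1 - X) ^ i * jacobiAtNegOne a b n) = 0 := by
  have hi₀ : (0 : ℝ) ≤ i := i.cast_nonneg
  have hsum := sum_choose_mul_ascPochhammer_div n (n + a + b + 1) (a + b + i + 2) (by linarith)
  have hneg : a + b + i + 2 - (n + a + b + 1) = -((n - 1 - i : ℕ) : ℝ) := by
    rw [Nat.sub_sub, Nat.cast_sub (by omega)]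
    push_cast
    ring
  rw [hneg, ascPochhammer_eval_neg_coe_nat_of_lt (by omega), zero_div] at hsum
  rw [jacobiAtNegOne, Finset.mul_sum, map_sum,
    ← mul_zero (2 ^ (a + b + i + 1) * Real.Gamma (a + i + 1) * Real.Gamma (b + 1)
        / Real.Gamma (a + b + i + 2)), ← hsum, Finset.mul_sum]
  refine Finset.sum_congr rfl fun j _ => ?_
  have := (ascPochhammer_pos j (b + 1) (by linarith)).ne'
  rw [mul_left_comm, ← smul_eq_C_mul, map_smul, smul_eq_mul,
    jacobiFunctional_one_sub_X_pow_mul_X_add_one_pow]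
  field_simp

theorem jacobiFunctional_mul_jacobiAtNegOne {p : ℝ[X]} {n : ℕ} (hp : p.degree < n) :
    jacobiFunctional a b ha hb (p * jacobiAtNegOne a b n) = 0 := by
  rcases eq_or_ne p 0 with rfl | hp₀
  · simp
  have hinv : (p.comp (1 - X)).comp (1 - X) = p := by
    simp [comp_assoc]
  have hdeg : (1 - X : ℝ[X]).natDegree = 1 := by
    rw [← natDegree_neg, neg_sub, ← C_1, natDegree_X_sub_C]
  rw [← hinv]
  refine jacobiFunctional_comp_mul_eq_zero ha hb
    (fun i hi => jacobiFunctional_one_sub_X_pow_mul_jacobiAtNegOne ha hb i n hi) ?_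
  refine degree_le_natDegree.trans_lt ?_
  rw [natDegree_comp, hdeg, mul_one]
  exact_mod_cast (natDegree_lt_iff_degree_lt hp₀).2 hp

theorem jacobiAtNegOne_eq_C_mul {P : ℝ[X]} {n : ℕ} (hdeg : P.natDegree = n) (hone : P.eval 1 = 1)
    (horth : ∀ i < n, jacobiFunctional a b ha hb (X ^ i * P) = 0) :
    jacobiAtNegOne a b n = C ((jacobiAtNegOne a b n).eval 1) * P := by
  have hP : P ≠ 0 := by
    rintro rfl
    simp at hone
  have hlead : P.coeff n ≠ 0 := by
    rw [← hdeg]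
    exact leadingCoeff_ne_zero.2 hP
  set Q := jacobiAtNegOne a b n with hQ
  set t := Q.coeff n / P.coeff n with ht
  have hlt : (Q - C t * P).degree < n := by
    rw [degree_lt_iff_coeff_zero]
    intro m hm
    rw [coeff_sub, coeff_C_mul]
    rcases hm.eq_or_lt with rfl | hm
    · rw [ht, div_mul_cancel₀ _ hlead, sub_self]
    · rw [coeff_eq_zero_of_natDegree_lt (p := P) (hdeg ▸ hm), coeff_eq_zero_of_degree_lt
        ((jacobiAtNegOne_degree_le n).trans_lt (by exact_mod_cast hm)), mul_zero, sub_zero]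
  have hzero : Q - C t * P = 0 := by
    refine eq_zero_of_jacobiFunctional_mul_self ha hb _ ?_
    have h := jacobiFunctional_comp_mul_eq_zero ha hb horth hlt
    rw [comp_X] at h
    conv_lhs => rw [mul_sub, mul_left_comm, ← smul_eq_C_mul t (p := _ * P)]
    rw [map_sub, map_smul, h, jacobiFunctional_mul_jacobiAtNegOne ha hb hlt, smul_zero, sub_zero]
  have hQP : Q = C t * P := sub_eq_zero.1 hzero
  have hval : Q.eval 1 = t := by rw [hQP, eval_mul, eval_C, hone, mul_one]
  rw [hval, ← hQP]

theorem iterate_derivative_eval_neg_one_of_orthogonal {P : ℝ[X]} {n k : ℕ} (hk : k ≤ n)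
    (hdeg : P.natDegree = n) (hone : P.eval 1 = 1)
    (horth : ∀ i < n, jacobiFunctional a b ha hb (X ^ i * P) = 0) :
    (-1) ^ n * (derivative^[k] P).eval (-1)
      = (-1) ^ k * (n.descFactorial k : ℝ) *
        ((ascPochhammer ℝ k).eval (n + a + b + 1) / (ascPochhammer ℝ k).eval (b + 1)) / 2 ^ k *
        ((ascPochhammer ℝ n).eval (b + 1) / (ascPochhammer ℝ n).eval (a + 1)) := by
  have h := jacobiAtNegOne_iterate_derivative_eval (a := a) (b := b) n k hk
  rw [jacobiAtNegOne_eq_C_mul ha hb hdeg hone horth, iterate_derivative_C_mul, eval_mul, eval_C,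
    jacobiAtNegOne_eval_one hb] at h
  rw [← h]
  have := (ascPochhammer_pos n (a + 1) (by linarith)).ne'
  have := (ascPochhammer_pos n (b + 1) (by linarith)).ne'
  have hsign : ((-1 : ℝ) ^ n) * (-1) ^ n = 1 := by rw [← mul_pow]; simp
  field_simp

end Jacobi

theorem tendsto_ascPochhammer_natCast_add_div_pow (s : ℝ) (k : ℕ) :
    Tendsto (fun n : ℕ => (ascPochhammer ℝ k).eval (n + s) / (n : ℝ) ^ k) atTop (nhds 1) := by
  induction k with
  | zero => simp
  | succ k ih =>
    have h : Tendsto (fun n : ℕ => 1 + (s + k) / (n : ℝ)) atTop (nhds 1) := by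
      simpa using (tendsto_const_div_atTop_nhds_zero_nat (s + k)).const_add 1
    have := ih.mul h
    rw [mul_one] at this
    refine this.congr' ?_
    filter_upwards [eventually_ne_atTop 0] with n hn
    rw [ascPochhammer_succ_eval]
    field_simp
    ring

theorem tendsto_descFactorial_div_pow (k : ℕ) :
    Tendsto (fun n : ℕ => (n.descFactorial k : ℝ) / (n : ℝ) ^ k) atTop (nhds 1) := by
  refine (tendsto_ascPochhammer_natCast_add_div_pow (1 - k) k).congr fun n => ?_
  rw [← descPochhammer_eval_eq_descFactorial, descPochhammer_eval_eq_ascPochhammer,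
    sub_add_eq_add_sub, add_sub_assoc]

theorem ascPochhammer_eval_eq_prod_range_add (n : ℕ) (s : ℝ) :
    (ascPochhammer ℝ n).eval s = ∏ j ∈ Finset.range n, (s + j) := by
  induction n with
  | zero => simp
  | succ n ih => rw [ascPochhammer_succ_eval, Finset.prod_range_succ, ih]

theorem tendsto_rpow_mul_factorial_div_ascPochhammer (s : ℝ) (hs : -1 < s) :
    Tendsto (fun n : ℕ => (n : ℝ) ^ s * (n.factorial : ℝ) / (ascPochhammer ℝ n).eval (s + 1))
      atTop (nhds (Real.Gamma (s + 1))) := by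
  have h : Tendsto (fun n : ℕ => 1 + (s + 1) / (n : ℝ)) atTop (nhds 1) := by
    simpa using (tendsto_const_div_atTop_nhds_zero_nat (s + 1)).const_add 1
  have := (Real.GammaSeq_tendsto_Gamma (s + 1)).mul h
  rw [mul_one] at this
  refine this.congr' ?_
  filter_upwards [eventually_gt_atTop 0] with n hn
  have hn' : (0 : ℝ) < n := by exact_mod_cast hn
  have := ascPochhammer_pos n (s + 1) (by linarith)
  have : s + 1 + n ≠ 0 := by linarith
  rw [Real.GammaSeq, ← ascPochhammer_eval_eq_prod_range_add, ascPochhammer_succ_eval,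
    Real.rpow_add_one hn'.ne']
  field_simp
  ring

theorem tendsto_ascPochhammer_div_ascPochhammer_div_rpow (a b : ℝ) (ha : -1 < a) (hb : -1 < b) :
    Tendsto (fun n : ℕ => (ascPochhammer ℝ n).eval (b + 1) / (ascPochhammer ℝ n).eval (a + 1)
        / (n : ℝ) ^ (b - a))
      atTop (nhds (Real.Gamma (a + 1) / Real.Gamma (b + 1))) := by
  refine ((tendsto_rpow_mul_factorial_div_ascPochhammer a ha).div
    (tendsto_rpow_mul_factorial_div_ascPochhammer b hb)
    (Real.Gamma_pos_of_pos (by linarith)).ne').congr' ?_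
  filter_upwards [eventually_gt_atTop 0] with n hn
  have hn' : (0 : ℝ) < n := by exact_mod_cast hn
  have := ascPochhammer_pos n (a + 1) (by linarith)
  have := ascPochhammer_pos n (b + 1) (by linarith)
  have := Real.rpow_pos_of_pos hn' a
  have := Real.rpow_pos_of_pos hn' b
  have := n.factorial_pos
  rw [Real.rpow_sub hn', Pi.div_apply]
  field_simp

theorem jacobi_derivative_asymptotics_at_minus_one
    (α β : ℝ) (hα : -1 < α) (hβ : -1 < β) (k : ℕ)
    (Pt : ℕ → ℝ[X])
    (hdeg : ∀ n, (Pt n).natDegree = n)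
    (hone : ∀ n, (Pt n).eval 1 = 1)
    (horth : ∀ n k, k < n →
      ∫ x in Set.Ioo (-1 : ℝ) 1, (Pt n).eval x * x ^ k * (1 - x) ^ α * (1 + x) ^ β = 0)
    : Tendsto (fun n : ℕ =>
        (-1 : ℝ) ^ n * ((⇑(derivative (R := ℝ)))^[k] (Pt n)).eval (-1)
          / (n : ℝ) ^ (-α + β + 2 * (k : ℝ)))
      atTop (nhds (Real.Gamma (α + 1) / ((-2 : ℝ) ^ k * Real.Gamma (β + k + 1)))) := by
  have hJ : ∀ n, ∀ i < n, jacobiFunctional α β hα hβ (X ^ i * Pt n) = 0 := fun n i hi => by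
    rw [jacobiFunctional_apply, ← horth n i hi]
    refine integral_congr_ae (ae_of_all _ fun x => ?_)
    simp only [eval_mul, eval_pow, eval_X]
    ring
  have hΓ := (Real.Gamma_pos_of_pos (show 0 < β + 1 by linarith)).ne'
  have hpoch := (ascPochhammer_pos k (β + 1) (by linarith)).ne'
  have hlim := (((tendsto_descFactorial_div_pow k).mul
    (tendsto_ascPochhammer_natCast_add_div_pow (α + β + 1) k)).mul
    (tendsto_ascPochhammer_div_ascPochhammer_div_rpow α β hα hβ)).const_mul
      ((-1) ^ k / ((ascPochhammer ℝ k).eval (β + 1) * 2 ^ k))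
  have hvalue : (-1) ^ k / ((ascPochhammer ℝ k).eval (β + 1) * 2 ^ k) *
      (1 * 1 * (Real.Gamma (α + 1) / Real.Gamma (β + 1)))
      = Real.Gamma (α + 1) / ((-2 : ℝ) ^ k * Real.Gamma (β + k + 1)) := by
    have hsign : ((-1 : ℝ) ^ k) * (-1) ^ k = 1 := by rw [← mul_pow]; simp
    rw [show β + k + 1 = β + 1 + k by ring, Real.Gamma_add_natCast _ (by linarith),
      neg_pow (2 : ℝ) k]
    field_simp
    linear_combination Real.Gamma (α + 1) * hsign
  rw [hvalue] at hlim
  refine hlim.congr' ?_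
  filter_upwards [eventually_gt_atTop 0, eventually_ge_atTop k] with n hn hkn
  have hn' : (0 : ℝ) < n := by exact_mod_cast hn
  rw [iterate_derivative_eval_neg_one_of_orthogonal hα hβ hkn (hdeg n) (hone n) (hJ n),
    show -α + β + 2 * (k : ℝ) = β - α + k + k by ring, Real.rpow_add_natCast hn'.ne',
    Real.rpow_add_natCast hn'.ne', show (n : ℝ) + α + β + 1 = n + (α + β + 1) by ring]
  have := (Real.rpow_pos_of_pos hn' (β - α)).ne'
  have := (ascPochhammer_pos n (α + 1) (by linarith)).ne'
  field_simp
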